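/- arXiv:2402.04629 — 4 statements merged into one kernel-verified Lean document; each statement's English description precedes it below -/
import Mathlib

section
/- Let G be an abelian group (viewed as a ℤ-module) and let a : ℕ → G be an infinite sequence of elements of G. If the family {a_i − a_0 : i ≥ 1} (i.e., the family fun i : ℕ => a (i+1) − a 0) is linearly independent over ℤ, then there exists a natural number N such that the family {a_i : i > N} (i.e., fun i : ℕ => a (N + 1 + i)) is linearly independent over ℤ. -/
theorem Finsupp.linearCombination_add_const {ι R M : Type*} [Semiring R] [AddCommMonoid M]
    [Module R M] (v : ι → M) (x : M) (l : ι →₀ R) :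
    Finsupp.linearCombination R (fun i => v i + x) l =
      Finsupp.linearCombination R v l + (l.sum fun _ c => c) • x := by
  simp [Finsupp.linearCombination_apply, Finsupp.sum, Finset.sum_add_distrib, Finset.sum_smul]

/-- Translating a linearly independent family by a fixed vector preserves linear independence
away from finitely many indices. -/
theorem LinearIndependent.exists_finset_linearIndepOn_add_const {ι R M : Type*} [CommRing R]
    [NoZeroDivisors R] [AddCommGroup M] [Module R M] {v : ι → M} (hv : LinearIndependent R v)
    (x : M) : ∃ s : Finset ι, LinearIndepOn R (fun i => v i + x) (s : Set ι)ᶜ := by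
  by_cases hvx : LinearIndependent R (fun i => v i + x)
  · exact ⟨∅, hvx.linearIndepOn _⟩
  rw [linearIndependent_iff] at hv
  obtain ⟨c, hc, hc0⟩ : ∃ c : ι →₀ R,
      Finsupp.linearCombination R (fun i => v i + x) c = 0 ∧ c ≠ 0 := by
    simpa [linearIndependent_iff] using hvx
  rw [Finsupp.linearCombination_add_const] at hc
  set t := c.sum fun _ r => r
  have ht : t ≠ 0 := fun ht => hc0 (hv c (by simpa [ht] using hc))
  refine ⟨c.support, linearIndepOn_iff.2 fun d hd hd0 => ?_⟩
  rw [Finsupp.linearCombination_add_const] at hd0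
  set u := d.sum fun _ r => r
  have key : t • d - u • c = 0 := hv _ <| by
    rw [map_sub, map_smul, map_smul, eq_neg_of_add_eq_zero_left hd0,
      eq_neg_of_add_eq_zero_left hc, smul_neg, smul_neg, smul_comm, sub_self]
  ext i
  by_cases hi : i ∈ c.support
  · by_contra hdi
    exact (Finsupp.mem_supported R d).1 hd (Finsupp.mem_support_iff.2 hdi) hi
  · have := DFunLike.congr_fun key i
    simpa [Finsupp.notMem_support_iff.1 hi, ht] using this

/-- **Lemma A.3.** Let `G` be an abelian group (a `ℤ`-module) and `a : ℕ → G` a sequence.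
If the family `{a i - a 0 : i ≥ 1}` is linearly independent over `ℤ`, then there is an `N`
such that the family `{a i : i > N}` is linearly independent over `ℤ`. -/
theorem tail_linearIndependent_of_affine_linearIndependent
    (G : Type*) [AddCommGroup G] (a : ℕ → G)
    (h : LinearIndependent ℤ (fun i : ℕ => a (i + 1) - a 0)) :
    ∃ N : ℕ, LinearIndependent ℤ (fun i : ℕ => a (N + 1 + i)) := by
  obtain ⟨s, hs⟩ := h.exists_finset_linearIndepOn_add_const (a 0)
  obtain ⟨N, hN⟩ := s.exists_nat_subset_range
  have hmem (i : ℕ) : N + i ∈ (s : Set ℕ)ᶜ := fun hi => by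
    have := Finset.mem_range.1 (hN hi)
    lia
  have hinj : Function.Injective fun i : ℕ => (⟨N + i, hmem i⟩ : ↥(s : Set ℕ)ᶜ) :=
    fun i j hij => by simpa using hij
  exact ⟨N, by simpa [Function.comp_def, add_right_comm] using hs.linearIndependent.comp _ hinj⟩
end

section
/- Let f be a polynomial with integer coefficients such that f has natDegree at least 1, the constant coefficient f.coeff 0 is nonzero, and f.eval 1 = 1 or f.eval 1 = −1. Let F be the element of LaurentPolynomial ℚ obtained from f by casting coefficients into ℚ and applying Polynomial.toLaurent, and let F* = LaurentPolynomial.invert F. Then F * F* does not divide F + F* in LaurentPolynomial ℚ. -/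
open LaurentPolynomial

/-- If `toLaurent q ∣ toLaurent p` and `q` has nonzero constant coefficient, then `q ∣ p`. -/
theorem Polynomial.dvd_of_toLaurent_dvd {K : Type*} [Field K] {p q : Polynomial K}
    (hq : q.coeff 0 ≠ 0) (h : toLaurent q ∣ toLaurent p) : q ∣ p := by
  obtain ⟨g, hg⟩ := h
  obtain ⟨m, g', hg'⟩ := LaurentPolynomial.exists_T_pow g
  have hcop : IsCoprime q (X ^ m) := by
    refine IsCoprime.pow_right (IsCoprime.symm ?_)
    rw [irreducible_X.coprime_iff_not_dvd, X_dvd_iff]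
    exact hq
  refine hcop.dvd_of_dvd_mul_right ⟨g', ?_⟩
  apply toLaurent_injective
  rw [map_mul, map_mul, toLaurent_X_pow, hg, hg', mul_assoc]

/-- A nonzero multiple of `p` of degree at most that of `p` is a constant multiple. -/
theorem Polynomial.exists_eq_mul_C_of_dvd {K : Type*} [Field K] {p q : Polynomial K}
    (hq : q ≠ 0) (h : p ∣ q) (hdeg : q.natDegree ≤ p.natDegree) : ∃ c : K, q = p * C c := by
  obtain ⟨g, rfl⟩ := h
  rw [natDegree_mul (left_ne_zero_of_mul hq) (right_ne_zero_of_mul hq)] at hdeg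
  exact ⟨g.coeff 0, by rw [← eq_C_of_natDegree_le_zero (by omega : g.natDegree ≤ 0)]⟩

/-- If `F * F* ∣ F + F*`, where `p(0) ≠ 0` and `p(1) ≠ 0`, then `p` divides `X ^ deg p + 1`. -/
theorem Polynomial.dvd_X_pow_natDegree_add_one {K : Type*} [Field K] {p : Polynomial K}
    (h0 : p.coeff 0 ≠ 0) (h1 : p.eval 1 ≠ 0)
    (h : toLaurent p * invert (toLaurent p) ∣ toLaurent p + invert (toLaurent p)) :
    p ∣ X ^ p.natDegree + 1 := by
  have hp : p ≠ 0 := by rintro rfl; simp at h0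
  have hrev := LaurentPolynomial.toLaurent_reverse p
  have hdvd : p * p.reverse ∣ p * X ^ p.natDegree + p.reverse := by
    apply dvd_of_toLaurent_dvd
    · rw [mul_coeff_zero, coeff_zero_reverse]
      exact mul_ne_zero h0 (leadingCoeff_ne_zero.mpr hp)
    · rw [map_mul, map_add, map_mul, hrev, toLaurent_X_pow, ← mul_assoc, ← add_mul]
      exact mul_dvd_mul_right h _
  have hpr : p ∣ p.reverse :=
    (dvd_add_right (dvd_mul_right p _)).mp ((dvd_mul_right p _).trans hdvd)
  obtain ⟨c, hc⟩ := exists_eq_mul_C_of_dvd (mt reverse_eq_zero.mp hp) hpr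
    (reverse_natDegree_le p)
  have heval : p.reverse.eval 1 = p.eval 1 := by
    let _ : Invertible (1 : K) := invertibleOne
    simpa [eval₂_eq_eval_map] using eval₂_reverse_mul_pow (RingHom.id K) 1 p
  have hc1 : c = 1 := by
    rw [hc, eval_mul, eval_C] at heval
    exact (mul_eq_left₀ h1).mp heval
  rw [hc1, map_one, mul_one] at hc
  rw [hc] at hdvd
  refine (mul_dvd_mul_iff_left hp).mp ?_
  rwa [mul_add, mul_one]

/-- Let `f ∈ ℤ[t]` with `natDegree f ≥ 1`, nonzero constant coefficient, and `f(1) = ±1`.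
Let `F ∈ ℚ[T;T⁻¹]` be the associated Laurent polynomial and `F* = invert F` (i.e.
`F*(t) = F(t⁻¹)`).  Then `F * F*` does not divide `F + F*` in `ℚ[T;T⁻¹]`. -/
theorem mul_invert_not_dvd_add_invert
    (f : Polynomial ℤ) (hdeg : 1 ≤ f.natDegree) (h0 : f.coeff 0 ≠ 0)
    (h1 : f.eval 1 = 1 ∨ f.eval 1 = -1) :
    ¬ ((Polynomial.toLaurent (f.map (Int.castRingHom ℚ))) *
          (LaurentPolynomial.invert (Polynomial.toLaurent (f.map (Int.castRingHom ℚ)))) ∣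
        (Polynomial.toLaurent (f.map (Int.castRingHom ℚ))) +
          (LaurentPolynomial.invert (Polynomial.toLaurent (f.map (Int.castRingHom ℚ))))) := by
  intro h
  set p := f.map (Int.castRingHom ℚ) with hp
  have hinj : Function.Injective (Int.castRingHom ℚ) := Int.cast_injective
  have hn : p.natDegree = f.natDegree := Polynomial.natDegree_map_eq_of_injective hinj f
  have hpf : p.coeff 0 = (f.coeff 0 : ℤ) := by simp [hp]
  have hp0 : p.coeff 0 ≠ 0 := by
    rw [hpf]
    exact_mod_cast h0
  have hp1 : p.eval 1 = (f.eval 1 : ℤ) := by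
    simp [hp, Polynomial.eval_map, Polynomial.eval₂_at_one]
  have hp1' : p.eval 1 ≠ 0 := by
    rw [hp1]
    rcases h1 with h1 | h1 <;> simp [h1]
  have hmonic : (Polynomial.X ^ p.natDegree + 1 : Polynomial ℚ).Monic :=
    Polynomial.monic_X_pow_add_C 1 (by omega)
  obtain ⟨c, hc⟩ := Polynomial.exists_eq_mul_C_of_dvd hmonic.ne_zero
    (Polynomial.dvd_X_pow_natDegree_add_one hp0 hp1' h)
    (Polynomial.natDegree_X_pow_add_C (r := (1 : ℚ))).le
  have hcoeff : 1 = (f.coeff 0 : ℚ) * c := by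
    rw [← hpf]
    have := congrArg (Polynomial.coeff · 0) hc
    simpa only [Polynomial.coeff_add, Polynomial.coeff_X_pow, Polynomial.coeff_one_zero,
      Polynomial.coeff_mul_C, if_neg (by omega : ¬0 = p.natDegree), zero_add] using this
  have heval : 2 = ((f.eval 1 : ℤ) : ℚ) * c := by
    rw [← hp1]
    have := congrArg (Polynomial.eval 1) hc
    rw [Polynomial.eval_mul, Polynomial.eval_C] at this
    rw [← this]
    norm_num
  have hodd : f.eval 1 = 2 * f.coeff 0 := by
    have : ((f.eval 1 : ℤ) : ℚ) = 2 * f.coeff 0 := by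
      linear_combination ((f.eval 1 : ℤ) : ℚ) * hcoeff - (f.coeff 0 : ℚ) * heval
    exact_mod_cast this
  omega
end

section
/- Let f be a polynomial with rational coefficients such that the constant coefficient f.coeff 0 is nonzero, and let d = natDegree f. Let F = Polynomial.toLaurent f in LaurentPolynomial ℚ and F* = LaurentPolynomial.invert F. If F divides F* in LaurentPolynomial ℚ, then there exists a nonzero rational number a such that F* = a • (T(−d) * F), and moreover a = 1 or a = −1. -/
open LaurentPolynomial

/-- Over a domain, divisibility of Laurent polynomials descends to polynomials when the divisor
has nonzero constant coefficient. -/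
theorem Polynomial.dvd_of_toLaurent_dvd_s4 {R : Type*} [CommRing R] [IsDomain R]
    {f p : Polynomial R} (h0 : f.coeff 0 ≠ 0)
    (h : Polynomial.toLaurent f ∣ Polynomial.toLaurent p) : f ∣ p := by
  obtain ⟨G, hG⟩ := h
  obtain ⟨n, g, hg⟩ := LaurentPolynomial.exists_T_pow G
  have key : p * Polynomial.X ^ n = f * g := by
    apply Polynomial.toLaurent_injective
    rw [map_mul, map_mul, Polynomial.toLaurent_X_pow, hG, hg, mul_assoc]
  have hX : ¬ Polynomial.X ∣ f := by rwa [Polynomial.X_dvd_iff]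
  obtain ⟨q, hq⟩ : Polynomial.X ^ n ∣ g :=
    Polynomial.prime_X.pow_dvd_of_dvd_mul_left n hX (key ▸ dvd_mul_left _ _)
  refine ⟨q, mul_right_cancel₀ (pow_ne_zero n Polynomial.X_ne_zero) ?_⟩
  rw [key, hq]
  ring

/-- If a polynomial with nonzero constant coefficient divides its reverse, the quotient is
`1` or `-1`. -/
theorem Polynomial.exists_reverse_eq_C_mul_of_dvd {R : Type*} [CommRing R] [IsDomain R]
    {f : Polynomial R} (h0 : f.coeff 0 ≠ 0) (h : f ∣ f.reverse) :
    ∃ a : R, f.reverse = Polynomial.C a * f ∧ (a = 1 ∨ a = -1) := by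
  have hf : f ≠ 0 := by
    rintro rfl
    simp at h0
  obtain ⟨q, hq⟩ := h
  have hq0 : q ≠ 0 := by
    rintro rfl
    rw [mul_zero, Polynomial.reverse_eq_zero] at hq
    exact hf hq
  have hdeg : q.natDegree = 0 := by
    have h1 := f.reverse_natDegree_le
    rw [hq, Polynomial.natDegree_mul hf hq0] at h1
    omega
  obtain ⟨a, rfl⟩ := Polynomial.natDegree_eq_zero.mp hdeg
  rw [mul_comm] at hq
  have hlow : f.leadingCoeff = a * f.coeff 0 := by
    rw [← Polynomial.coeff_zero_reverse, hq, Polynomial.coeff_C_mul]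
  have hhigh : f.coeff 0 = a * f.leadingCoeff := by
    have h1 := f.coeff_reverse f.natDegree
    rw [Polynomial.revAt_le le_rfl, Nat.sub_self, hq, Polynomial.coeff_C_mul] at h1
    exact h1.symm
  refine ⟨a, hq, mul_self_eq_one_iff.mp (mul_right_cancel₀ h0 ?_)⟩
  rw [one_mul, mul_assoc, ← hlow, ← hhigh]

/-- Let `f ∈ ℚ[t]` with nonzero constant coefficient and `d = natDegree f`.  Let
`F ∈ ℚ[T;T⁻¹]` be the associated Laurent polynomial and `F* = invert F`.  If `F ∣ F*`,
then `F* = a • (T(-d) * F)` for some nonzero rational `a`, and moreover `a = ±1`. -/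
theorem invert_eq_smul_T_neg_natDegree_of_dvd
    (f : Polynomial ℚ) (h0 : f.coeff 0 ≠ 0)
    (hdvd : (Polynomial.toLaurent f) ∣ LaurentPolynomial.invert (Polynomial.toLaurent f)) :
    ∃ a : ℚ, a ≠ 0 ∧
      LaurentPolynomial.invert (Polynomial.toLaurent f) =
        a • (LaurentPolynomial.T (-(f.natDegree : ℤ)) * Polynomial.toLaurent f) ∧
      (a = 1 ∨ a = -1) := by
  have hrev : f ∣ f.reverse := by
    apply Polynomial.dvd_of_toLaurent_dvd_s4 h0
    rw [toLaurent_reverse]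
    exact hdvd.mul_right _
  obtain ⟨a, ha, hsign⟩ := Polynomial.exists_reverse_eq_C_mul_of_dvd h0 hrev
  refine ⟨a, by rcases hsign with rfl | rfl <;> norm_num, ?_, hsign⟩
  have hF := toLaurent_reverse f
  rw [ha, Polynomial.toLaurent_C_mul_eq] at hF
  rw [smul_eq_C_mul, T_mul, ← mul_assoc, hF, mul_T_assoc, add_neg_cancel, T_zero, mul_one]
end

section
/- Let R = LaurentPolynomial ℚ = ℚ[t,t⁻¹] with the involution p ↦ p̄ given by LaurentPolynomial.invert (t ↦ t⁻¹). Let F = RatFunc ℚ = ℚ(t), regarded as an R-module via the ℚ-algebra embedding R ↪ F sending t to X, let R′ ⊆ F be the image of R (an R-submodule of F), and let Q = F/R′ be the quotient R-module. The ℚ-algebra automorphism of F determined by X ↦ X⁻¹ preserves R′ and hence descends to an additive involution ξ ↦ ξ̄ of Q. Let M be an R-module and B : M → M → Q a pairing which is additive in each variable, R-linear in the second variable in the sense that B(x, p·y) = p·B(x,y) for all p ∈ R, and Hermitian in the sense that B(y,x) = conjugate of B(x,y) for all x, y. Suppose that M is annihilated by the image in R of a polynomial Δ ∈ ℤ[t]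 with Δ.eval 1 = 1 or Δ.eval 1 = −1 (i.e., Δ·x = 0 for all x ∈ M), and that B is not identically zero (there exist x, y ∈ M with B(x,y) ≠ 0). Then there exists η ∈ M with B(η,η) ≠ 0. -/
open Polynomial in
/-- A polynomial over a field without a root at `a` is coprime to `X - a`. -/
theorem Polynomial.isCoprime_X_sub_C_of_eval_ne_zero {K : Type*} [Field K] {p : K[X]} {a : K}
    (h : p.eval a ≠ 0) : IsCoprime p (X - C a) :=
  ((irreducible_X_sub_C a).coprime_iff_not_dvd.2 fun hd => h (dvd_iff_isRoot.1 hd)).symm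

open Polynomial in
/-- An integral polynomial with value `±1` at `1` is coprime to `X ^ 2 - 1` over `ℚ`: its value
at `-1` is odd. -/
theorem Polynomial.isCoprime_map_X_sq_sub_one {p : ℤ[X]} (h : p.eval 1 = 1 ∨ p.eval 1 = -1) :
    IsCoprime (p.map (Int.castRingHom ℚ)) (X ^ 2 - 1) := by
  have hsub : (2 : ℤ) ∣ p.eval 1 - p.eval (-1) := by
    simpa using p.sub_dvd_eval_sub 1 (-1)
  have h_one : (p.map (Int.castRingHom ℚ)).eval 1 ≠ 0 := by
    have := p.eval_intCast_map (Int.castRingHom ℚ) 1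
    simp only [Int.cast_one] at this
    rw [this]
    rcases h with h | h <;> simp [h]
  have h_neg : (p.map (Int.castRingHom ℚ)).eval (-1) ≠ 0 := by
    have := p.eval_intCast_map (Int.castRingHom ℚ) (-1)
    simp only [Int.cast_neg, Int.cast_one] at this
    rw [this]
    intro hz
    rw [eq_intCast, Int.cast_eq_zero] at hz
    omega
  have hfac : (X ^ 2 - 1 : ℚ[X]) = (X - C 1) * (X - C (-1)) := by
    simp only [map_neg, map_one]
    ring
  rw [hfac]
  exact (isCoprime_X_sub_C_of_eval_ne_zero h_one).mul_right
    (isCoprime_X_sub_C_of_eval_ne_zero h_neg)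


/-- **Lemma A.2 (algebraic content).**  Let `R = ℚ[t,t⁻¹]` (Laurent polynomials) with the
involution `invert` (`t ↦ t⁻¹`), let `F = ℚ(t)` (rational functions), regarded as an
`R`-module via the `ℚ`-algebra embedding `ι : R → F` with `ι t = X`, let `R′ = ι(R)` and
let `Q = F/R′`, realized as an abelian group `Q` with a surjective additive map
`π : F → Q` whose kernel is `R′`.  The `ℚ`-algebra automorphism `σ` of `F` with
`σ X = X⁻¹` preserves `R′` and descends to an additive involution `conj` of `Q`, and
multiplication by `p ∈ R` descends to an action `qsmul` on `Q`.  Let `M` be an `R`-module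
and `B : M → M → Q` a pairing, additive in each variable, `R`-linear in the second
variable, and Hermitian.  If `M` is annihilated by the image in `R` of a polynomial
`Δ ∈ ℤ[t]` with `Δ(1) = ±1`, and `B` is not identically zero, then there is `η ∈ M` with
`B η η ≠ 0`. -/
theorem exists_self_pairing_ne_zero
    (ι : LaurentPolynomial ℚ →ₐ[ℚ] RatFunc ℚ)
    (hι_inj : Function.Injective ι)
    (hι : ι (LaurentPolynomial.T 1) = RatFunc.X)
    (σ : RatFunc ℚ ≃ₐ[ℚ] RatFunc ℚ)
    (hσ : σ RatFunc.X = (RatFunc.X)⁻¹)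
    (Q : Type*) [AddCommGroup Q]
    (π : RatFunc ℚ →+ Q)
    (hπ_surj : Function.Surjective π)
    (hπ_ker : ∀ ξ : RatFunc ℚ, π ξ = 0 ↔ ξ ∈ Set.range ι)
    (conj : Q →+ Q)
    (hconj : ∀ ξ : RatFunc ℚ, conj (π ξ) = π (σ ξ))
    (qsmul : LaurentPolynomial ℚ → Q → Q)
    (hqsmul : ∀ (p : LaurentPolynomial ℚ) (ξ : RatFunc ℚ), qsmul p (π ξ) = π (ι p * ξ))
    (M : Type*) [AddCommGroup M] [Module (LaurentPolynomial ℚ) M]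
    (B : M → M → Q)
    (hB_add_left : ∀ x x' y : M, B (x + x') y = B x y + B x' y)
    (hB_add_right : ∀ x y y' : M, B x (y + y') = B x y + B x y')
    (hB_smul : ∀ (p : LaurentPolynomial ℚ) (x y : M), B x (p • y) = qsmul p (B x y))
    (hB_herm : ∀ x y : M, B y x = conj (B x y))
    (Δ : Polynomial ℤ)
    (hΔ1 : Δ.eval 1 = 1 ∨ Δ.eval 1 = -1)
    (hann : ∀ x : M, (Polynomial.toLaurent (Δ.map (Int.castRingHom ℚ))) • x = 0)
    (hB_ne : ∃ x y : M, B x y ≠ 0) :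
    ∃ η : M, B η η ≠ 0 := by
  obtain ⟨x, y, hxy⟩ := hB_ne
  by_contra! hzero
  have h_alt : ∀ x y : M, B y x = -B x y := fun x y => by
    have h := hzero (x + y)
    rw [hB_add_left, hB_add_right, hB_add_right, hzero, hzero, zero_add, add_zero] at h
    exact eq_neg_of_add_eq_zero_right h
  obtain ⟨ξ, hξ⟩ := hπ_surj (B x y)
  have hmem : ∀ ζ : RatFunc ℚ, π ζ = 0 ↔ ζ ∈ ι.range := hπ_ker
  have hT_inv : ι (LaurentPolynomial.T (-1)) = (RatFunc.X)⁻¹ := by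
    refine eq_inv_of_mul_eq_one_left ?_
    rw [← hι, ← map_mul, ← LaurentPolynomial.T_add]
    simp
  have hB_smul_eq (p : LaurentPolynomial ℚ) : B x (p • y) = π (ι p * ξ) := by
    rw [hB_smul, ← hξ, hqsmul]
  have h_ann : ι (Polynomial.toLaurent (Δ.map (Int.castRingHom ℚ))) * ξ ∈ ι.range := by
    rw [← hmem, ← hB_smul_eq, hann]
    simpa using hB_add_right x 0 0
  have h_conj : π (σ ξ) = π (-ξ) := by
    rw [← hconj, hξ, ← hB_herm, h_alt, map_neg, hξ]
  have h_conj_X : π (RatFunc.X⁻¹ * σ ξ) = π (-(RatFunc.X * ξ)) := by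
    have h := hB_herm x ((LaurentPolynomial.T 1 : LaurentPolynomial ℚ) • y)
    rw [h_alt, hB_smul_eq, hconj, map_mul σ, hι, hσ] at h
    rw [← h, map_neg]
  have h_twist : π (RatFunc.X⁻¹ * σ ξ) = π (RatFunc.X⁻¹ * -ξ) := by
    rw [← hT_inv, ← hqsmul, ← hqsmul, h_conj]
  have h_sub : RatFunc.X * ξ - RatFunc.X⁻¹ * ξ ∈ ι.range := by
    rw [← hmem, map_sub, sub_eq_zero]
    have h := h_conj_X.symm.trans h_twist
    rw [mul_neg, map_neg, map_neg] at h
    exact neg_injective h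
  have h_sq : ι (Polynomial.toLaurent (Polynomial.X ^ 2 - 1)) * ξ ∈ ι.range := by
    have h := mul_mem (⟨_, hι⟩ : RatFunc.X ∈ ι.range) h_sub
    convert h using 1
    simp only [map_sub, map_pow, map_one, Polynomial.toLaurent_X, hι]
    field_simp [RatFunc.X_ne_zero (K := ℚ)]
  obtain ⟨u, v, huv⟩ := Polynomial.isCoprime_map_X_sq_sub_one hΔ1
  have h_bezout := congrArg (fun p => ι (Polynomial.toLaurent p) * ξ) huv
  simp only [map_add, map_mul, map_one, one_mul, add_mul, mul_assoc] at h_bezout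
  refine hxy (hξ ▸ (hmem ξ).2 ?_)
  rw [← h_bezout]
  exact add_mem (mul_mem ⟨_, rfl⟩ h_ann) (mul_mem ⟨_, rfl⟩ h_sq)
end
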